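/- arXiv:2011.11262 — 2 statements merged into one kernel-verified Lean document; each statement's English description precedes it below -/
import Mathlib

section
/- Let P(t) = a t^4 + b t^3 + c t^2 + d t + e with a > 0 and e > 0, and Δ as in the quartic discriminant expression. Then P(t) > 0 for all real t if and only if either (1) Δ = 0, b√e = d√a, and b^2 + 8a√(ae) = 4ac < 24a√(ae); or (2) Δ > 0, |b√e − d√a| ≤ 4√(ace + 2ae√(ae)), and either (i) −2√(ae) ≤ c ≤ 6√(ae), or (ii) c > 6√(ae) and |b√e + d√a| ≤ 4√(ace − 2ae√(ae)). -/
/-- The determinant of the Gram matrix with corner entry `m` of the quartic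
`s ^ 4 + p * s ^ 3 + q * s ^ 2 + r * s + 1`; as a polynomial in `m` it is a resolvent cubic. -/
noncomputable def gramCubic (p q r m : ℝ) : ℝ :=
  2 * m ^ 3 - q * m ^ 2 + (p * r / 2 - 2) * m + q - (p ^ 2 + r ^ 2) / 4

/-- The discriminant of the quartic `s ^ 4 + p * s ^ 3 + q * s ^ 2 + r * s + 1`, times `27`. -/
noncomputable def normalizedDisc (p q r : ℝ) : ℝ :=
  4 * (12 - 3 * (p * r) + q ^ 2) ^ 3 -
    (72 * q + 9 * (p * q * r) - 2 * q ^ 3 - 27 * r ^ 2 - 27 * p ^ 2) ^ 2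

lemma gramCubic_eq (p q r m : ℝ) :
    gramCubic p q r m =
      (1 - m ^ 2) * (q - 2 * m) - (p + r) ^ 2 * (1 - m) / 8 - (p - r) ^ 2 * (1 + m) / 8 := by
  unfold gramCubic; ring

lemma quartic_pos_of_gramCubic_pos {p q r m : ℝ} (h₁ : -1 < m) (h₂ : m < 1)
    (h : 0 < gramCubic p q r m) (s : ℝ) :
    0 < s ^ 4 + p * s ^ 3 + q * s ^ 2 + r * s + 1 := by
  have hm : 0 < 1 - m ^ 2 := by nlinarith
  have key : (1 - m ^ 2) * (s ^ 4 + p * s ^ 3 + q * s ^ 2 + r * s + 1) =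
      (1 - m ^ 2) * (s ^ 2 + p / 2 * s + m) ^ 2 +
        ((1 - m ^ 2) + (r - p * m) / 2 * s) ^ 2 + gramCubic p q r m * s ^ 2 := by
    unfold gramCubic; ring
  refine pos_of_mul_pos_right (a := 1 - m ^ 2) ?_ hm.le
  rw [key]
  rcases eq_or_ne s 0 with rfl | hs
  · have : 0 < (1 - m ^ 2) ^ 2 := by positivity
    nlinarith [mul_nonneg hm.le (sq_nonneg m)]
  · positivity

/-- A monic real quartic is a product of two monic real quadratics. -/
lemma exists_quadratic_factors (p q r w : ℝ) :
    ∃ b₁ c₁ b₂ c₂ : ℝ, ∀ s : ℝ, s ^ 4 + p * s ^ 3 + q * s ^ 2 + r * s + w =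
      (s ^ 2 + b₁ * s + c₁) * (s ^ 2 + b₂ * s + c₂) := by
  have hf : Polynomial.IsMonicOfDegree (Polynomial.X ^ 4 + (Polynomial.C p * Polynomial.X ^ 3 +
      Polynomial.C q * Polynomial.X ^ 2 + Polynomial.C r * Polynomial.X + Polynomial.C w) :
        Polynomial ℝ) 4 := by
    refine (Polynomial.isMonicOfDegree_X_pow ℝ 4).add_right ?_
    refine lt_of_le_of_lt (Polynomial.natDegree_cubic_le) (by norm_num)
  obtain ⟨f₁, f₂, h₁, h₂, hmul⟩ :=
    hf.eq_isMonicOfDegree_two_mul_isMonicOfDegree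
  obtain ⟨b₁, c₁, rfl⟩ := Polynomial.isMonicOfDegree_two_iff.mp h₁
  obtain ⟨b₂, c₂, rfl⟩ := Polynomial.isMonicOfDegree_two_iff.mp h₂
  refine ⟨b₁, c₁, b₂, c₂, fun s => ?_⟩
  have := congrArg (Polynomial.eval s) hmul
  simp only [Polynomial.eval_add, Polynomial.eval_mul, Polynomial.eval_pow, Polynomial.eval_X,
    Polynomial.eval_C] at this
  linarith

lemma sq_lt_four_mul_of_forall_ne_zero {b c : ℝ} (h : ∀ s : ℝ, s ^ 2 + b * s + c ≠ 0) :
    b ^ 2 < 4 * c := by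
  by_contra! hc
  apply h ((-b + √(b ^ 2 - 4 * c)) / 2)
  linear_combination Real.sq_sqrt (sub_nonneg.mpr hc) / 4

lemma exists_gramCubic_pos {p q r : ℝ}
    (h : ∀ s : ℝ, 0 < s ^ 4 + p * s ^ 3 + q * s ^ 2 + r * s + 1) :
    ∃ m, -1 < m ∧ m < 1 ∧ 0 < gramCubic p q r m := by
  obtain ⟨b₁, c₁, b₂, c₂, hf⟩ := exists_quadratic_factors p q r 1
  have h₁ : b₁ ^ 2 < 4 * c₁ := sq_lt_four_mul_of_forall_ne_zero fun s hs => by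
    have := h s; rw [hf, hs, zero_mul] at this; exact this.false
  have h₂ : b₂ ^ 2 < 4 * c₂ := sq_lt_four_mul_of_forall_ne_zero fun s hs => by
    have := h s; rw [hf, hs, mul_zero] at this; exact this.false
  have e0 := hf 0
  have e1 := hf 1
  have e2 := hf (-1)
  have e3 := hf 2
  have e4 := hf (-2)
  have hw : c₁ * c₂ = 1 := by linear_combination -e0
  have hp : p = b₁ + b₂ := by linear_combination (e3 - e4) / 12 - (e1 - e2) / 6
  have hq : q = c₁ + c₂ + b₁ * b₂ := by linear_combination (e1 + e2) / 2 - e0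
  have hr : r = b₁ * c₂ + b₂ * c₁ := by linear_combination 2 * (e1 - e2) / 3 - (e3 - e4) / 12
  have hc₁ : 0 < c₁ := by nlinarith [sq_nonneg b₁]
  have hc₂ : 0 < c₂ := by nlinarith [sq_nonneg b₂]
  have hb : (b₁ * b₂) ^ 2 < 4 ^ 2 := by
    calc (b₁ * b₂) ^ 2 = b₁ ^ 2 * b₂ ^ 2 := by ring
      _ < (4 * c₁) * (4 * c₂) := mul_lt_mul'' h₁ h₂ (sq_nonneg _) (sq_nonneg _)
      _ = 4 ^ 2 := by linear_combination 16 * hw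
  obtain ⟨hl, hu⟩ := abs_lt.mp (abs_lt_of_sq_lt_sq hb (by norm_num))
  have hc : 2 ≤ c₁ + c₂ := by nlinarith [sq_nonneg (c₁ - c₂)]
  refine ⟨b₁ * b₂ / 4, by linarith, by linarith, ?_⟩
  have key : gramCubic p q r (b₁ * b₂ / 4) =
      2 * (c₁ - b₁ ^ 2 / 4) * (c₂ - b₂ ^ 2 / 4) * ((c₁ + c₂) / 2 - b₁ * b₂ / 4) := by
    subst hp hq hr
    unfold gramCubic
    linear_combination ((b₁ ^ 2 + b₂ ^ 2) / 4 - c₁ - c₂) * hw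
  rw [key]
  have := sub_pos.mpr h₁
  have := sub_pos.mpr h₂
  refine mul_pos (mul_pos (mul_pos two_pos ?_) ?_) ?_ <;> linarith

/-- A cubic that is nonpositive at `±1` but positive in between has all its roots real. -/
lemma exists_roots_gramCubic {p q r m : ℝ} (h₁ : -1 < m) (h₂ : m < 1)
    (h : 0 < gramCubic p q r m) :
    ∃ x y z, x < m ∧ m < y ∧ y ≤ 1 ∧ 1 ≤ z ∧
      ∀ t, gramCubic p q r t = 2 * (t - x) * (t - y) * (t - z) := by
  have hcont : Continuous (gramCubic p q r) := by unfold gramCubic; fun_prop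
  have hl : gramCubic p q r (-1) ≤ 0 := by rw [gramCubic_eq]; nlinarith [sq_nonneg (p + r)]
  have hu : gramCubic p q r 1 ≤ 0 := by rw [gramCubic_eq]; nlinarith [sq_nonneg (p - r)]
  obtain ⟨x, hx, hx0⟩ := intermediate_value_Icc h₁.le hcont.continuousOn ⟨hl, h.le⟩
  obtain ⟨y, hy, hy0⟩ := intermediate_value_Icc' h₂.le hcont.continuousOn ⟨hu, h.le⟩
  have hxm : x < m := lt_of_le_of_ne hx.2 (by rintro rfl; linarith)
  have hmy : m < y := lt_of_le_of_ne hy.1 (by rintro rfl; linarith)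
  have hfac : ∀ t, gramCubic p q r t = 2 * (t - x) * (t - y) * (t - (q / 2 - x - y)) := by
    intro t
    have hxy : x - y ≠ 0 := (sub_neg.mpr (hxm.trans hmy)).ne
    apply mul_left_cancel₀ hxy
    unfold gramCubic at *
    linear_combination (t - y) * hx0 - (t - x) * hy0
  set z := q / 2 - x - y
  rcases le_or_gt 1 z with hz | hz
  · exact ⟨x, y, z, hxm, hmy, hy.2, hz, hfac⟩
  · have hy1 : 1 ≤ y := by
      by_contra! hy1
      have : 0 < 2 * (1 - x) * (1 - y) * (1 - z) := by
        refine mul_pos (mul_pos (mul_pos two_pos ?_) ?_) ?_ <;> linarith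
      rw [← hfac] at this
      linarith
    have hmz : m < z := by
      by_contra! hmz
      have : 0 ≤ 2 * (m - x) * (y - m) * (m - z) := by
        refine mul_nonneg (mul_nonneg (mul_nonneg two_pos.le ?_) ?_) ?_ <;> linarith
      rw [hfac] at h
      linarith
    exact ⟨x, z, y, hxm, hmz, hz.le, hy1, fun t => by rw [hfac]; ring⟩

lemma normalizedDisc_of_roots {p q r x y z : ℝ}
    (h : ∀ t, gramCubic p q r t = 2 * (t - x) * (t - y) * (t - z)) :
    normalizedDisc p q r = 1728 * ((x - y) * (x - z) * (y - z)) ^ 2 := by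
  have e0 := h 0
  have e1 := h 1
  have e2 := h (-1)
  unfold gramCubic at e0 e1 e2
  have hq : q = 2 * (x + y + z) := by linear_combination e0 - (e1 + e2) / 2
  have hpr : p * r = 4 * (x * y + x * z + y * z) + 4 := by linear_combination e1 - e2
  have hs : p ^ 2 + r ^ 2 = 8 * (x + y + z) + 8 * (x * y * z) := by
    linear_combination -4 * e0 + 4 * hq
  have : normalizedDisc p q r = 4 * (12 - 3 * (p * r) + q ^ 2) ^ 3 -
      (72 * q + 9 * (q * (p * r)) - 2 * q ^ 3 - 27 * (p ^ 2 + r ^ 2)) ^ 2 := by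
    unfold normalizedDisc; ring
  rw [this, hpr, hs, hq]
  ring

lemma exists_gramCubic_pos_of_disc_pos {p q r : ℝ} (hΔ : 0 < normalizedDisc p q r)
    (hv : (p - r) ^ 2 ≤ 16 * (q + 2)) (hq : -2 ≤ q)
    (hu : 6 < q → (p + r) ^ 2 ≤ 16 * (q - 2)) :
    ∃ m, -1 < m ∧ m < 1 ∧ 0 < gramCubic p q r m := by
  have hI : 0 < 12 - 3 * (p * r) + q ^ 2 := by
    by_contra! hI
    have := Odd.pow_nonpos (n := 3) (by decide) hI
    unfold normalizedDisc at hΔ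
    nlinarith [sq_nonneg (72 * q + 9 * (p * q * r) - 2 * q ^ 3 - 27 * r ^ 2 - 27 * p ^ 2)]
  set s := √(12 - 3 * (p * r) + q ^ 2) with hs
  have hs0 : 0 < s := Real.sqrt_pos.mpr hI
  have hs2 : s ^ 2 = 12 - 3 * (p * r) + q ^ 2 := Real.sq_sqrt hI.le
  set R := 72 * q + 9 * (p * q * r) - 2 * q ^ 3 - 27 * r ^ 2 - 27 * p ^ 2 with hR
  have hRs : R ^ 2 < (2 * s ^ 3) ^ 2 := by
    have : normalizedDisc p q r = 4 * (s ^ 2) ^ 3 - R ^ 2 := by rw [hs2]; rfl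
    nlinarith
  have hR' := (abs_lt.mp (abs_lt_of_sq_lt_sq hRs (by positivity))).1
  have hval : gramCubic p q r ((q - s) / 6) = (2 * s ^ 3 + R) / 108 := by
    rw [hR]; unfold gramCubic
    linear_combination -s / 36 * hs2
  have hpos : 0 < gramCubic p q r ((q - s) / 6) := by rw [hval]; linarith
  refine ⟨(q - s) / 6, lt_of_le_of_ne ?_ ?_, lt_of_le_of_ne ?_ ?_, hpos⟩
  · have : s ≤ q + 6 := abs_le_of_sq_le_sq' (by nlinarith [sq_nonneg (p + r)]) (by linarith) |>.2
    linarith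
  · intro h
    rw [← h, gramCubic_eq] at hpos
    nlinarith [sq_nonneg (p + r)]
  · rcases le_or_gt q 6 with h6 | h6
    · linarith
    · have : q - 6 ≤ s :=
        abs_le_of_sq_le_sq' (by nlinarith [hu h6, sq_nonneg (p - r)]) hs0.le |>.2
      linarith
  · intro h
    rw [h, gramCubic_eq] at hpos
    nlinarith [sq_nonneg (p - r)]

lemma bounds_of_gramCubic_pos {p q r m : ℝ} (h₁ : -1 < m) (h₂ : m < 1)
    (h : 0 < gramCubic p q r m) :
    (p - r) ^ 2 ≤ 16 * (q + 2) ∧ -2 ≤ q ∧ (6 < q → (p + r) ^ 2 ≤ 16 * (q - 2)) := by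
  rw [gramCubic_eq] at h
  have hl : 0 < 1 + m := by linarith
  have hr : 0 < 1 - m := by linarith
  have hu0 := mul_nonneg (sq_nonneg (p + r)) hr.le
  have hv0 := mul_nonneg (sq_nonneg (p - r)) hl.le
  have hq : 2 * m < q := by
    have : 0 < (1 - m ^ 2) * (q - 2 * m) := by linarith
    have := pos_of_mul_pos_right this (by nlinarith)
    linarith
  have hv : (p - r) ^ 2 < 8 * (1 - m) * (q - 2 * m) := by
    refine lt_of_mul_lt_mul_left (a := 1 + m) ?_ hl.le
    nlinarith
  have hu : (p + r) ^ 2 < 8 * (1 + m) * (q - 2 * m) := by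
    refine lt_of_mul_lt_mul_left (a := 1 - m) ?_ hr.le
    nlinarith
  refine ⟨by nlinarith, by linarith, fun h6 => by nlinarith⟩

lemma normalized_quartic_pos_iff (p q r : ℝ) :
    (∀ s : ℝ, 0 < s ^ 4 + p * s ^ 3 + q * s ^ 2 + r * s + 1) ↔
      (normalizedDisc p q r = 0 ∧ p = r ∧ p ^ 2 + 8 = 4 * q ∧ q < 6) ∨
      (0 < normalizedDisc p q r ∧ (p - r) ^ 2 ≤ 16 * (q + 2) ∧
        ((-2 ≤ q ∧ q ≤ 6) ∨ (6 < q ∧ (p + r) ^ 2 ≤ 16 * (q - 2)))) := by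
  constructor
  · intro h
    obtain ⟨m, h₁, h₂, hm⟩ := exists_gramCubic_pos h
    obtain ⟨x, y, z, hx, hy, hy1, hz, hfac⟩ := exists_roots_gramCubic h₁ h₂ hm
    have hΔ := normalizedDisc_of_roots hfac
    obtain ⟨hv, hq, hu⟩ := bounds_of_gramCubic_pos h₁ h₂ hm
    rcases (hy1.trans hz).eq_or_lt with hyz | hyz
    · left
      obtain rfl : y = 1 := by linarith
      obtain rfl : z = 1 := by linarith
      have e0 := hfac 0
      have e1 := hfac 1
      have e2 := hfac (-1)
      unfold gramCubic at e0 e1 e2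
      have hpr : p = r := by
        have : (p - r) ^ 2 = 0 := by linear_combination -4 * e1
        exact sub_eq_zero.mp (pow_eq_zero_iff two_ne_zero |>.mp this)
      subst hpr
      have hqx : q = 2 * (x + 2) := by linear_combination e0 - (e1 + e2) / 2
      refine ⟨by rw [hΔ]; ring, rfl, ?_, by linarith⟩
      linear_combination e1 - e2 - 4 * hqx
    · right
      refine ⟨?_, hv, ?_⟩
      · rw [hΔ]
        have h1 : x - y ≠ 0 := (sub_neg.mpr (hx.trans hy)).ne
        have h2 : x - z ≠ 0 := (sub_neg.mpr ((hx.trans hy).trans hyz)).ne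
        have h3 : y - z ≠ 0 := (sub_neg.mpr hyz).ne
        positivity
      · rcases le_or_gt q 6 with h6 | h6
        · exact Or.inl ⟨hq, h6⟩
        · exact Or.inr ⟨h6, hu h6⟩
  · rintro (⟨-, rfl, hpq, hq⟩ | ⟨hΔ, hv, hq⟩) s
    · have key : s ^ 4 + p * s ^ 3 + q * s ^ 2 + p * s + 1 = (s ^ 2 + p / 2 * s + 1) ^ 2 := by
        linear_combination -s ^ 2 / 4 * hpq
      have : 0 < s ^ 2 + p / 2 * s + 1 := by nlinarith [sq_nonneg (s + p / 4)]
      rw [key]; positivity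
    · obtain ⟨m, h₁, h₂, hm⟩ := exists_gramCubic_pos_of_disc_pos hΔ hv
        (by rcases hq with h | h <;> linarith [h.1])
        (fun h6 => by
          rcases hq with h | h
          · linarith [h.2]
          · exact h.2)
      exact quartic_pos_of_gramCubic_pos h₁ h₂ hm s

lemma abs_le_four_mul_sqrt_iff {x y : ℝ} (hy : 0 ≤ y) : |x| ≤ 4 * √y ↔ x ^ 2 ≤ 16 * y := by
  rw [← abs_of_nonneg (show 0 ≤ 4 * √y by positivity), ← sq_le_sq, mul_pow, Real.sq_sqrt hy]
  norm_num

theorem quartic_pos_iff (a b c d e : ℝ) (ha : 0 < a) (he : 0 < e) :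
    (∀ t : ℝ, 0 < a * t ^ 4 + b * t ^ 3 + c * t ^ 2 + d * t + e) ↔
      ((4 * (12 * a * e - 3 * b * d + c ^ 2) ^ 3 -
          (72 * a * c * e + 9 * b * c * d - 2 * c ^ 3 - 27 * a * d ^ 2 -
            27 * b ^ 2 * e) ^ 2 = 0 ∧
        b * Real.sqrt e = d * Real.sqrt a ∧
        b ^ 2 + 8 * a * Real.sqrt (a * e) = 4 * a * c ∧
        4 * a * c < 24 * a * Real.sqrt (a * e)) ∨
      (0 < 4 * (12 * a * e - 3 * b * d + c ^ 2) ^ 3 -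
          (72 * a * c * e + 9 * b * c * d - 2 * c ^ 3 - 27 * a * d ^ 2 -
            27 * b ^ 2 * e) ^ 2 ∧
        |b * Real.sqrt e - d * Real.sqrt a| ≤
          4 * Real.sqrt (a * c * e + 2 * a * e * Real.sqrt (a * e)) ∧
        ((-2 * Real.sqrt (a * e) ≤ c ∧ c ≤ 6 * Real.sqrt (a * e)) ∨
          (6 * Real.sqrt (a * e) < c ∧
            |b * Real.sqrt e + d * Real.sqrt a| ≤
              4 * Real.sqrt (a * c * e - 2 * a * e * Real.sqrt (a * e)))))) := by
  obtain ⟨k, hk, hka⟩ : ∃ k, 0 < k ∧ a = k ^ 4 :=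
    ⟨√√a, by positivity, by
      rw [show (4 : ℕ) = 2 * 2 from rfl, pow_mul, Real.sq_sqrt (by positivity), Real.sq_sqrt ha.le]⟩
  obtain ⟨l, hl, hle⟩ : ∃ l, 0 < l ∧ e = l ^ 4 :=
    ⟨√√e, by positivity, by
      rw [show (4 : ℕ) = 2 * 2 from rfl, pow_mul, Real.sq_sqrt (by positivity), Real.sq_sqrt he.le]⟩
  obtain ⟨p, rfl⟩ : ∃ p, b = p * (k ^ 3 * l) := ⟨b / (k ^ 3 * l), by field_simp⟩
  obtain ⟨q, rfl⟩ : ∃ q, c = q * (k ^ 2 * l ^ 2) := ⟨c / (k ^ 2 * l ^ 2), by field_simp⟩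
  obtain ⟨r, rfl⟩ : ∃ r, d = r * (k * l ^ 3) := ⟨d / (k * l ^ 3), by field_simp⟩
  subst hka hle
  have sk : √(k ^ 4) = k ^ 2 := by
    rw [show k ^ 4 = (k ^ 2) ^ 2 by ring, Real.sqrt_sq (by positivity)]
  have sl : √(l ^ 4) = l ^ 2 := by
    rw [show l ^ 4 = (l ^ 2) ^ 2 by ring, Real.sqrt_sq (by positivity)]
  have skl : √(k ^ 4 * l ^ 4) = k ^ 2 * l ^ 2 := by
    rw [Real.sqrt_mul (by positivity), sk, sl]
  have hP : (∀ t : ℝ, 0 < k ^ 4 * t ^ 4 + p * (k ^ 3 * l) * t ^ 3 + q * (k ^ 2 * l ^ 2) * t ^ 2 +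
      r * (k * l ^ 3) * t + l ^ 4) ↔
      ∀ s : ℝ, 0 < s ^ 4 + p * s ^ 3 + q * s ^ 2 + r * s + 1 := by
    constructor
    · intro h s
      refine pos_of_mul_pos_right (a := l ^ 4) ?_ (by positivity)
      refine (h (s * l / k)).trans_eq ?_
      field_simp
    · intro h t
      refine (mul_pos (pow_pos hl 4) (h (k * t / l))).trans_eq ?_
      field_simp
  have hΔ : 4 * (12 * k ^ 4 * l ^ 4 - 3 * (p * (k ^ 3 * l)) * (r * (k * l ^ 3)) +
        (q * (k ^ 2 * l ^ 2)) ^ 2) ^ 3 -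
      (72 * k ^ 4 * (q * (k ^ 2 * l ^ 2)) * l ^ 4 +
        9 * (p * (k ^ 3 * l)) * (q * (k ^ 2 * l ^ 2)) * (r * (k * l ^ 3)) -
        2 * (q * (k ^ 2 * l ^ 2)) ^ 3 - 27 * k ^ 4 * (r * (k * l ^ 3)) ^ 2 -
        27 * (p * (k ^ 3 * l)) ^ 2 * l ^ 4) ^ 2 = (k * l) ^ 12 * normalizedDisc p q r := by
    unfold normalizedDisc; ring
  have hkl : 0 < k * l := by positivity
  have hsqrt : ∀ x : ℝ, √((k * l) ^ 6 * x) = (k * l) ^ 3 * √x := fun x => by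
    rw [Real.sqrt_mul (by positivity), show (k * l) ^ 6 = ((k * l) ^ 3) ^ 2 by ring,
      Real.sqrt_sq (by positivity)]
  have habs : ∀ x y : ℝ, |(k * l) ^ 3 * x| ≤ 4 * √((k * l) ^ 6 * y) ↔ |x| ≤ 4 * √y :=
    fun x y => by
      rw [hsqrt, abs_mul, abs_of_pos (pow_pos hkl 3), mul_left_comm,
        mul_le_mul_iff_right₀ (pow_pos hkl 3)]
  have h1 : p * (k ^ 3 * l) * l ^ 2 = r * (k * l ^ 3) * k ^ 2 ↔ p = r := by
    rw [show p * (k ^ 3 * l) * l ^ 2 = (k * l) ^ 3 * p by ring,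
      show r * (k * l ^ 3) * k ^ 2 = (k * l) ^ 3 * r by ring]
    exact mul_right_inj' (by positivity)
  have h2 : (p * (k ^ 3 * l)) ^ 2 + 8 * k ^ 4 * (k ^ 2 * l ^ 2) =
      4 * k ^ 4 * (q * (k ^ 2 * l ^ 2)) ↔ p ^ 2 + 8 = 4 * q := by
    rw [← mul_right_inj' (b := p ^ 2 + 8) (show k ^ 6 * l ^ 2 ≠ 0 by positivity)]
    ring_nf
  have h3 : 4 * k ^ 4 * (q * (k ^ 2 * l ^ 2)) < 24 * k ^ 4 * (k ^ 2 * l ^ 2) ↔ q < 6 := by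
    rw [← mul_lt_mul_iff_right₀ (b := q) (show 0 < 4 * k ^ 6 * l ^ 2 by positivity)]
    ring_nf
  have h4 : -2 * (k ^ 2 * l ^ 2) ≤ q * (k ^ 2 * l ^ 2) ↔ -2 ≤ q :=
    mul_le_mul_iff_left₀ (by positivity)
  have h5 : q * (k ^ 2 * l ^ 2) ≤ 6 * (k ^ 2 * l ^ 2) ↔ q ≤ 6 :=
    mul_le_mul_iff_left₀ (by positivity)
  have h6 : 6 * (k ^ 2 * l ^ 2) < q * (k ^ 2 * l ^ 2) ↔ 6 < q :=
    mul_lt_mul_iff_left₀ (by positivity)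
  have h7 : |p * (k ^ 3 * l) * l ^ 2 - r * (k * l ^ 3) * k ^ 2| ≤
      4 * √(k ^ 4 * (q * (k ^ 2 * l ^ 2)) * l ^ 4 + 2 * k ^ 4 * l ^ 4 * (k ^ 2 * l ^ 2)) ↔
      |p - r| ≤ 4 * √(q + 2) := by
    rw [← habs (p - r)]; ring_nf
  have h8 : |p * (k ^ 3 * l) * l ^ 2 + r * (k * l ^ 3) * k ^ 2| ≤
      4 * √(k ^ 4 * (q * (k ^ 2 * l ^ 2)) * l ^ 4 - 2 * k ^ 4 * l ^ 4 * (k ^ 2 * l ^ 2)) ↔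
      |p + r| ≤ 4 * √(q - 2) := by
    rw [← habs (p + r)]; ring_nf
  rw [hP, hΔ, skl, sk, sl, h1, h2, h3, h4, h5, h6, h7, h8, normalized_quartic_pos_iff]
  have h9 : (k * l) ^ 12 * normalizedDisc p q r = 0 ↔ normalizedDisc p q r = 0 :=
    mul_eq_zero_iff_left (by positivity)
  have h10 : 0 < (k * l) ^ 12 * normalizedDisc p q r ↔ 0 < normalizedDisc p q r :=
    mul_pos_iff_of_pos_left (by positivity)
  rw [h9, h10]
  refine or_congr_right (and_congr_right fun _ => ?_)
  rcases lt_or_ge q (-2) with hq | hq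
  · constructor <;> rintro ⟨-, h | h⟩ <;> linarith [h.1]
  · rw [abs_le_four_mul_sqrt_iff (by linarith)]
    refine and_congr_right fun _ => or_congr_right (and_congr_right fun h => ?_)
    rw [abs_le_four_mul_sqrt_iff (by linarith)]
end

section
/- Let V be a 4th order 2-dimensional symmetric tensor with v_{1111} > 0 and v_{2222} > 0, and I, J as above. Then V(x) ≥ 0 for all x ∈ ℝ^2 if and only if I^3 − 27 J^2 ≥ 0, |v_{1112}√v_{2222} − v_{1222}√v_{1111}| ≤ √(6 v_{1111} v_{1122} v_{2222} + 2√((v_{1111} v_{2222})^3)), and either (i) −√(v_{1111} v_{2222}) ≤ 3 v_{1122} ≤ 3√(v_{1111} v_{2222}), or (ii) v_{1122} > √(v_{1111} v_{2222}) and |v_{1112}√v_{2222} + v_{1222}√v_{1111}| ≤ √(6 v_{1111} v_{1122} v_{2222} − 2√((v_{1111} v_{2222})^3)). -/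
/-- A monic real cubic is a product of a monic linear factor and a monic quadratic. -/
theorem exists_linear_mul_quadratic (a b c : ℝ) :
    ∃ u p q : ℝ, ∀ t : ℝ, t ^ 3 + a * t ^ 2 + b * t + c = (t + u) * (t ^ 2 + p * t + q) := by
  obtain ⟨z, hz⟩ := IsAlgClosed.exists_root
    (Polynomial.X ^ 3 + Polynomial.C (a : ℂ) * Polynomial.X ^ 2 + Polynomial.C (b : ℂ) *
      Polynomial.X + Polynomial.C (c : ℂ)) (by
        rw [show Polynomial.degree _ = ((3 : ℕ) : WithBot ℕ) by compute_degree!]; norm_num)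
  obtain ⟨x, y⟩ := z
  simp only [Polynomial.IsRoot, Polynomial.eval_add, Polynomial.eval_mul,
    Polynomial.eval_X, Polynomial.eval_C, Complex.ext_iff, pow_succ, pow_zero, one_mul,
    Complex.add_re, Complex.add_im, Complex.mul_re, Complex.mul_im, Complex.ofReal_re,
    Complex.ofReal_im, Complex.zero_re, Complex.zero_im] at hz
  obtain ⟨hre, him⟩ := hz
  by_cases hy : y = 0
  · subst hy
    refine ⟨-x, a + x, b + x * (a + x), fun t => ?_⟩
    linear_combination hre
  · have him' : 3 * x ^ 2 - y ^ 2 + 2 * a * x + b = 0 := by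
      apply mul_left_cancel₀ hy
      linear_combination him
    refine ⟨a + 2 * x, -2 * x, x ^ 2 + y ^ 2, fun t => ?_⟩
    linear_combination hre + (t - x) * him'

/-- A monic real quartic is a product of two monic real quadratics. -/
theorem exists_quadratic_mul_quadratic (a b c d : ℝ) :
    ∃ p q r s : ℝ, ∀ t : ℝ, t ^ 4 + a * t ^ 3 + b * t ^ 2 + c * t + d =
      (t ^ 2 + p * t + q) * (t ^ 2 + r * t + s) := by
  obtain ⟨z, hz⟩ := IsAlgClosed.exists_root
    (Polynomial.X ^ 4 + Polynomial.C (a : ℂ) * Polynomial.X ^ 3 + Polynomial.C (b : ℂ) *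
      Polynomial.X ^ 2 + Polynomial.C (c : ℂ) * Polynomial.X + Polynomial.C (d : ℂ)) (by
        rw [show Polynomial.degree _ = ((4 : ℕ) : WithBot ℕ) by compute_degree!]; norm_num)
  obtain ⟨x, y⟩ := z
  simp only [Polynomial.IsRoot, Polynomial.eval_add, Polynomial.eval_mul,
    Polynomial.eval_X, Polynomial.eval_C, Complex.ext_iff, pow_succ, pow_zero, one_mul,
    Complex.add_re, Complex.add_im, Complex.mul_re, Complex.mul_im, Complex.ofReal_re,
    Complex.ofReal_im, Complex.zero_re, Complex.zero_im] at hz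
  obtain ⟨hre, him⟩ := hz
  by_cases hy : y = 0
  · subst hy
    obtain ⟨u, p, q, h⟩ := exists_linear_mul_quadratic (a + x) (b + x * (a + x))
      (c + x * (b + x * (a + x)))
    refine ⟨u - x, -x * u, p, q, fun t => ?_⟩
    linear_combination hre + (t - x) * h t
  · have him' : 4 * x ^ 3 - 4 * x * y ^ 2 + a * (3 * x ^ 2 - y ^ 2) + 2 * b * x + c = 0 := by
      apply mul_left_cancel₀ hy
      linear_combination him
    refine ⟨-2 * x, x ^ 2 + y ^ 2, a + 2 * x,
      b + 2 * x * (a + 2 * x) - (x ^ 2 + y ^ 2), fun t => ?_⟩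
    linear_combination hre + (t - x) * him'

/-- The coefficients of a normalized quartic written as a product of two quadratics. -/
theorem coeff_eq_of_factorization {a b c p q r s : ℝ}
    (h : ∀ t : ℝ, t ^ 4 + 4 * a * t ^ 3 + 6 * c * t ^ 2 + 4 * b * t + 1 =
      (t ^ 2 + p * t + q) * (t ^ 2 + r * t + s)) :
    4 * a = p + r ∧ 6 * c = q + s + p * r ∧ 4 * b = p * s + q * r ∧ q * s = 1 := by
  have h0 := h 0
  have h1 := h 1
  have h2 := h (-1)
  have h3 := h 2
  refine ⟨?_, ?_, ?_, ?_⟩ <;> linarith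

/-- The discriminant of a product of two quadratics. -/
theorem discr_eq_of_factorization {a b c p q r s : ℝ} (ha : 4 * a = p + r)
    (hc : 6 * c = q + s + p * r) (hb : 4 * b = p * s + q * r) (hd : q * s = 1) :
    256 * ((1 - 4 * a * b + 3 * c ^ 2) ^ 3 -
        27 * (c + 2 * a * c * b - c ^ 3 - b ^ 2 - a ^ 2) ^ 2) =
      (p ^ 2 - 4 * q) * (r ^ 2 - 4 * s) * ((q - s) ^ 2 - (p - r) * (q * r - p * s)) ^ 2 := by
  obtain rfl : a = (p + r) / 4 := by linarith
  obtain rfl : c = (q + s + p * r) / 6 := by linarith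
  obtain rfl : b = (p * s + q * r) / 4 := by linarith
  have e1 : 1 - 4 * ((p + r) / 4) * ((p * s + q * r) / 4) + 3 * ((q + s + p * r) / 6) ^ 2 =
      q * s - 4 * ((p + r) / 4) * ((p * s + q * r) / 4) + 3 * ((q + s + p * r) / 6) ^ 2 := by
    rw [hd]
  have e2 : (q + s + p * r) / 6 + 2 * ((p + r) / 4) * ((q + s + p * r) / 6) *
        ((p * s + q * r) / 4) - ((q + s + p * r) / 6) ^ 3 - ((p * s + q * r) / 4) ^ 2 -
        ((p + r) / 4) ^ 2 =
      q * s * ((q + s + p * r) / 6) + 2 * ((p + r) / 4) * ((q + s + p * r) / 6) *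
        ((p * s + q * r) / 4) - ((q + s + p * r) / 6) ^ 3 - ((p * s + q * r) / 4) ^ 2 -
        q * s * ((p + r) / 4) ^ 2 := by
    rw [hd]; ring
  rw [e1, e2]
  ring

/-- The resultant of a quadratic with real roots and one without is nonzero. -/
theorem resultant_ne_zero {p q r s : ℝ} (h1 : 0 < p ^ 2 - 4 * q) (h2 : r ^ 2 - 4 * s < 0) :
    (q - s) ^ 2 - (p - r) * (q * r - p * s) ≠ 0 := by
  -- sixteen times the resultant, in terms of the centres and discriminants
  have key : 16 * ((q - s) ^ 2 - (p - r) * (q * r - p * s)) =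
      ((p - r) ^ 2 - (p ^ 2 - 4 * q) - (r ^ 2 - 4 * s)) ^ 2 -
        4 * (p ^ 2 - 4 * q) * (r ^ 2 - 4 * s) := by ring
  nlinarith [mul_pos h1 (neg_pos.2 h2),
    sq_nonneg ((p - r) ^ 2 - (p ^ 2 - 4 * q) - (r ^ 2 - 4 * s))]

theorem quadratic_nonneg {p q : ℝ} (h : p ^ 2 - 4 * q ≤ 0) (t : ℝ) : 0 ≤ t ^ 2 + p * t + q := by
  nlinarith [sq_nonneg (2 * t + p)]

theorem discr_nonneg_of_nonneg {a b c : ℝ}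
    (h : ∀ t : ℝ, 0 ≤ t ^ 4 + 4 * a * t ^ 3 + 6 * c * t ^ 2 + 4 * b * t + 1) :
    0 ≤ (1 - 4 * a * b + 3 * c ^ 2) ^ 3 -
        27 * (c + 2 * a * c * b - c ^ 3 - b ^ 2 - a ^ 2) ^ 2 := by
  obtain ⟨p, q, r, s, hf⟩ := exists_quadratic_mul_quadratic (4 * a) (6 * c) (4 * b) 1
  obtain ⟨ha, hc, hb, hd⟩ := coeff_eq_of_factorization hf
  have key := discr_eq_of_factorization ha hc hb hd
  -- a quadratic with real roots times a positive one changes sign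
  have aux : ∀ {p q r s : ℝ}, (∀ t : ℝ, 0 ≤ (t ^ 2 + p * t + q) * (t ^ 2 + r * t + s)) →
      0 < p ^ 2 - 4 * q → r ^ 2 - 4 * s < 0 → False := by
    intro p q r s h h1 h2
    have e1 : (-p / 2) ^ 2 + p * (-p / 2) + q < 0 := by linarith
    have e2 : 0 < (-p / 2) ^ 2 + r * (-p / 2) + s := by linarith [sq_nonneg (2 * (-p / 2) + r)]
    exact (h (-p / 2)).not_gt (mul_neg_of_neg_of_pos e1 e2)
  have hD : 0 ≤ (p ^ 2 - 4 * q) * (r ^ 2 - 4 * s) := by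
    by_contra! hneg
    rcases mul_neg_iff.1 hneg with ⟨h1, h2⟩ | ⟨h1, h2⟩
    · exact aux (fun t => (h t).trans_eq (hf t)) h1 h2
    · exact aux (fun t => (h t).trans_eq ((hf t).trans (mul_comm _ _))) h2 h1
  have := mul_nonneg hD (sq_nonneg ((q - s) ^ 2 - (p - r) * (q * r - p * s)))
  linarith

theorem sub_sq_le_of_nonneg {a b c : ℝ}
    (h : ∀ t : ℝ, 0 ≤ t ^ 4 + 4 * a * t ^ 3 + 6 * c * t ^ 2 + 4 * b * t + 1) :
    (a - b) ^ 2 ≤ 6 * c + 2 := by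
  -- evaluate at the two solutions of `t - 1 / t = b - a`
  set w := √((b - a) ^ 2 + 4)
  have hw2 : w ^ 2 = (b - a) ^ 2 + 4 := Real.sq_sqrt (by positivity)
  have hpos : 0 < w := Real.sqrt_pos.2 (by positivity)
  obtain ⟨t, ht⟩ : ∃ t, t = ((b - a) + w) / 2 := ⟨_, rfl⟩
  have hq : t ^ 2 = (b - a) * t + 1 := by subst ht; linear_combination (1 / 4) * hw2
  have ht0 : t ≠ 0 := by rintro rfl; norm_num at hq
  have e1 := div_nonneg (h t) (sq_nonneg t)
  have e2 := mul_nonneg (h (-1 / t)) (sq_nonneg t)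
  have hba : b - a = t - 1 / t := by field_simp; linarith
  have e : (t ^ 4 + 4 * a * t ^ 3 + 6 * c * t ^ 2 + 4 * b * t + 1) / t ^ 2 +
      ((-1 / t) ^ 4 + 4 * a * (-1 / t) ^ 3 + 6 * c * (-1 / t) ^ 2 + 4 * b * (-1 / t) + 1) * t ^ 2 =
      2 * ((t - 1 / t) ^ 2 + 2 + 6 * c + 2 * (a - b) * (t - 1 / t)) := by
    field_simp; ring
  rw [← hba] at e
  nlinarith

theorem add_sq_le_of_nonneg {a b c : ℝ}
    (h : ∀ t : ℝ, 0 ≤ t ^ 4 + 4 * a * t ^ 3 + 6 * c * t ^ 2 + 4 * b * t + 1) (hc : 1 < c) :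
    (a + b) ^ 2 ≤ 6 * c - 2 := by
  -- evaluate at the two solutions of `t + 1 / t = -(a + b)`, if these are real
  rcases le_or_gt ((a + b) ^ 2) 4 with h4 | h4
  · linarith
  set w := √((a + b) ^ 2 - 4)
  have hw2 : w ^ 2 = (a + b) ^ 2 - 4 := Real.sq_sqrt (by linarith)
  obtain ⟨t, ht⟩ : ∃ t, t = (-(a + b) + w) / 2 := ⟨_, rfl⟩
  have hq : t ^ 2 = -(a + b) * t - 1 := by subst ht; linear_combination (1 / 4) * hw2
  have ht0 : t ≠ 0 := by rintro rfl; norm_num at hq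
  have e1 := div_nonneg (h t) (sq_nonneg t)
  have e2 := mul_nonneg (h (1 / t)) (sq_nonneg t)
  have hba : -(a + b) = t + 1 / t := by field_simp; linarith
  have e : (t ^ 4 + 4 * a * t ^ 3 + 6 * c * t ^ 2 + 4 * b * t + 1) / t ^ 2 +
      ((1 / t) ^ 4 + 4 * a * (1 / t) ^ 3 + 6 * c * (1 / t) ^ 2 + 4 * b * (1 / t) + 1) * t ^ 2 =
      2 * ((t + 1 / t) ^ 2 - 2 + 6 * c + 2 * (a + b) * (t + 1 / t)) := by
    field_simp; ring
  rw [← hba] at e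
  nlinarith

/-- Two real-rooted quadratics, each with roots of equal sign, scaled so that their constant
coefficients are `k ^ 2` and `l ^ 2` with `k * l = 1`. -/
theorem nonneg_of_scaled_quadratics {a b c k l P R : ℝ} (hk : 0 < k) (hkl : k * l = 1)
    (hP : 4 ≤ P ^ 2) (hR : 4 ≤ R ^ 2)
    (ha : 4 * a = k * P + l * R) (hc : 6 * c = k ^ 2 + l ^ 2 + P * R)
    (hb : 4 * b = l * P + k * R)
    (h1 : (a - b) ^ 2 ≤ 6 * c + 2) (h2 : c ≤ 1 ∨ (a + b) ^ 2 ≤ 6 * c - 2) (t : ℝ) :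
    0 ≤ (t ^ 2 + k * P * t + k ^ 2) * (t ^ 2 + l * R * t + l ^ 2) := by
  have hl : 0 < l := by
    by_contra! hl
    nlinarith
  have nonneg_of_sq : P ^ 2 = 4 → R ^ 2 = 4 →
      0 ≤ (t ^ 2 + k * P * t + k ^ 2) * (t ^ 2 + l * R * t + l ^ 2) := by
    intro hP hR
    apply mul_nonneg <;> apply quadratic_nonneg
    · nlinarith
    · nlinarith
  have hPR4 : 16 ≤ (P * R) ^ 2 := by nlinarith
  rcases lt_or_ge (P * R) 0 with hneg | hpos
  · have hPR : P * R ≤ -4 := by nlinarith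
    have e : (k - l) ^ 2 * ((P - R) ^ 2 - 16) + 16 * (-(P * R) - 4) ≤ 0 := by
      have : 16 * (a - b) ^ 2 = (k - l) ^ 2 * (P - R) ^ 2 := by
        linear_combination (4 * a - 4 * b + (k * P + l * R) - (l * P + k * R)) * (ha - hb)
      nlinarith
    have hd : 0 ≤ (P - R) ^ 2 - 16 := by nlinarith
    have hPR' : P * R = -4 := by nlinarith [mul_nonneg (sq_nonneg (k - l)) hd]
    have : P ^ 2 * R ^ 2 = 16 := by rw [← mul_pow, hPR']; norm_num
    exact nonneg_of_sq (by nlinarith) (by nlinarith)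
  · have hPR : 4 ≤ P * R := by nlinarith
    have hK : 2 ≤ k ^ 2 + l ^ 2 := by nlinarith [sq_nonneg (k - l)]
    rcases h2 with h2 | h2
    · have hPR' : P * R = 4 := by linarith
      have : P ^ 2 * R ^ 2 = 16 := by rw [← mul_pow, hPR']; norm_num
      exact nonneg_of_sq (by nlinarith) (by nlinarith)
    · have e : (k - l) ^ 2 * ((P + R) ^ 2 - 16) + 4 * (P - R) ^ 2 ≤ 0 := by
        have : 16 * (a + b) ^ 2 = (k + l) ^ 2 * (P + R) ^ 2 := by
          linear_combination (4 * a + 4 * b + (k * P + l * R) + (l * P + k * R)) * (ha + hb)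
        have e2 : (k + l) ^ 2 = (k - l) ^ 2 + 4 := by linear_combination 4 * hkl
        rw [e2] at this
        have e3 : 6 * c = (k - l) ^ 2 + 2 + P * R := by linear_combination hc + 2 * hkl
        nlinarith
      have hd : 0 ≤ (P + R) ^ 2 - 16 := by nlinarith
      have hm := mul_nonneg (sq_nonneg (k - l)) hd
      have hPR0 : P - R = 0 := by
        have : (P - R) ^ 2 = 0 := le_antisymm (by linarith) (sq_nonneg _)
        exact pow_eq_zero_iff two_ne_zero |>.1 this
      obtain rfl : P = R := by linarith
      have : (k - l) ^ 2 * ((P + P) ^ 2 - 16) = 0 := le_antisymm (by nlinarith) hm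
      rcases mul_eq_zero.1 this with h | h
      · have : k - l = 0 := pow_eq_zero_iff two_ne_zero |>.1 h
        obtain rfl : k = l := by linarith
        exact mul_self_nonneg _
      · exact nonneg_of_sq (by linarith) (by linarith)

theorem nonneg_of_real_roots_of_pos {a b c x y z w : ℝ} (hxy : 0 < x * y)
    (ha : 4 * a = -(x + y + z + w))
    (hc : 6 * c = x * y + z * w + (x + y) * (z + w))
    (hb : 4 * b = -((x + y) * (z * w) + (x * y) * (z + w))) (hd : x * y * z * w = 1)
    (h1 : (a - b) ^ 2 ≤ 6 * c + 2) (h2 : c ≤ 1 ∨ (a + b) ^ 2 ≤ 6 * c - 2) (t : ℝ) :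
    0 ≤ (t - x) * (t - y) * (t - z) * (t - w) := by
  obtain ⟨k, hk, hk2⟩ : ∃ k : ℝ, 0 < k ∧ k ^ 2 = x * y :=
    ⟨√(x * y), Real.sqrt_pos.2 hxy, Real.sq_sqrt hxy.le⟩
  obtain ⟨l, hkl⟩ : ∃ l : ℝ, k * l = 1 := ⟨k⁻¹, mul_inv_cancel₀ hk.ne'⟩
  have hl2 : l ^ 2 = z * w := by
    apply mul_left_cancel₀ hxy.ne'
    linear_combination (k * l + 1) * hkl - l ^ 2 * hk2 - hd
  have hP : k * (-l * (x + y)) = -(x + y) := by linear_combination -(x + y) * hkl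
  have hR : l * (-k * (z + w)) = -(z + w) := by linear_combination -(z + w) * hkl
  have key := nonneg_of_scaled_quadratics (a := a) (b := b) (c := c) hk hkl
    (P := -l * (x + y)) (R := -k * (z + w)) ?_ ?_ ?_ ?_ ?_ h1 h2 t
  · rw [hP, hR, hk2, hl2] at key
    linarith
  · have : (-l * (x + y)) ^ 2 = 4 + l ^ 2 * (x - y) ^ 2 := by
      linear_combination 4 * (k * l + 1) * hkl - 4 * l ^ 2 * hk2
    rw [this]; nlinarith [sq_nonneg (l * (x - y))]
  · have : (-k * (z + w)) ^ 2 = 4 + k ^ 2 * (z - w) ^ 2 := by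
      linear_combination 4 * (k * l + 1) * hkl - 4 * k ^ 2 * hl2
    rw [this]; nlinarith [sq_nonneg (k * (z - w))]
  · rw [hP, hR]; linarith
  · linear_combination hc - hk2 - hl2 - (x + y) * (z + w) * hkl
  · linear_combination hb + (x + y) * hl2 + (z + w) * hk2

theorem nonneg_of_real_roots {a b c x y z w : ℝ}
    (ha : 4 * a = -(x + y + z + w))
    (hc : 6 * c = x * y + z * w + (x + y) * (z + w))
    (hb : 4 * b = -((x + y) * (z * w) + (x * y) * (z + w))) (hd : x * y * z * w = 1)
    (h1 : (a - b) ^ 2 ≤ 6 * c + 2) (h2 : c ≤ 1 ∨ (a + b) ^ 2 ≤ 6 * c - 2) (t : ℝ) :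
    0 ≤ (t - x) * (t - y) * (t - z) * (t - w) := by
  have hne : x * y * z ≠ 0 := fun h => by rw [h, zero_mul] at hd; norm_num at hd
  have hx : x ≠ 0 := fun h => hne (by rw [h]; ring)
  have hy : y ≠ 0 := fun h => hne (by rw [h]; ring)
  have hz : z ≠ 0 := fun h => hne (by rw [h]; ring)
  rcases lt_or_ge 0 (x * y) with h | hxy
  · exact nonneg_of_real_roots_of_pos h ha hc hb hd h1 h2 t
  rcases lt_or_ge 0 (x * z) with h | hxz
  · have := nonneg_of_real_roots_of_pos (a := a) (b := b) (c := c) (z := y) (w := w) h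
      (by linarith) (by linarith) (by linarith) (by linarith) h1 h2 t
    linarith
  have h : 0 < y * z := by
    have h1 : x * y < 0 := lt_of_le_of_ne hxy (mul_ne_zero hx hy)
    have h2 : x * z < 0 := lt_of_le_of_ne hxz (mul_ne_zero hx hz)
    have := mul_pos_of_neg_of_neg h1 h2
    have hx2 : 0 < x ^ 2 := by positivity
    exact pos_of_mul_pos_right (a := x ^ 2) (by linarith) hx2.le
  have := nonneg_of_real_roots_of_pos (a := a) (b := b) (c := c) (z := x) (w := w) h
      (by linarith) (by linarith) (by linarith) (by linarith) h1 h2 t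
  linarith

theorem exists_roots_of_discr_nonneg {p q : ℝ} (h : 0 ≤ p ^ 2 - 4 * q) :
    ∃ x y : ℝ, p = -(x + y) ∧ q = x * y :=
  ⟨(-p + √(p ^ 2 - 4 * q)) / 2, (-p - √(p ^ 2 - 4 * q)) / 2, by ring, by
    linear_combination (1 / 4) * Real.sq_sqrt h⟩

theorem nonneg_of_discr_nonneg {a b c : ℝ}
    (hD : 0 ≤ (1 - 4 * a * b + 3 * c ^ 2) ^ 3 -
        27 * (c + 2 * a * c * b - c ^ 3 - b ^ 2 - a ^ 2) ^ 2)
    (h1 : (a - b) ^ 2 ≤ 6 * c + 2) (h2 : c ≤ 1 ∨ (a + b) ^ 2 ≤ 6 * c - 2) (t : ℝ) :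
    0 ≤ t ^ 4 + 4 * a * t ^ 3 + 6 * c * t ^ 2 + 4 * b * t + 1 := by
  obtain ⟨p, q, r, s, hf⟩ := exists_quadratic_mul_quadratic (4 * a) (6 * c) (4 * b) 1
  obtain ⟨ha, hc, hb, hd⟩ := coeff_eq_of_factorization hf
  have key := discr_eq_of_factorization ha hc hb hd
  have aux : ∀ {D E S : ℝ}, 0 ≤ D * E * S ^ 2 → 0 < D → E < 0 → S ≠ 0 → False := by
    intro D E S h hD hE hS
    have := mul_neg_of_neg_of_pos (mul_neg_of_pos_of_neg hD hE) (pow_pos (abs_pos.2 hS) 2)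
    rw [sq_abs] at this
    linarith
  rw [hf t]
  rcases le_or_gt (p ^ 2 - 4 * q) 0 with hp | hp <;> rcases le_or_gt (r ^ 2 - 4 * s) 0 with hr | hr
  · exact mul_nonneg (quadratic_nonneg hp t) (quadratic_nonneg hr t)
  all_goals
    have hp' : 0 ≤ p ^ 2 - 4 * q := by
      by_contra! hp'
      have hS := resultant_ne_zero (p := r) (q := s) (r := p) (s := q) (by linarith) hp'
      refine aux (D := r ^ 2 - 4 * s) (E := p ^ 2 - 4 * q) ?_ (by linarith) hp' hS
      linarith
    have hr' : 0 ≤ r ^ 2 - 4 * s := by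
      by_contra! hr'
      have hS := resultant_ne_zero (p := p) (q := q) (r := r) (s := s) (by linarith) hr'
      refine aux (D := p ^ 2 - 4 * q) (E := r ^ 2 - 4 * s) ?_ (by linarith) hr' hS
      linarith
    obtain ⟨x, y, rfl, rfl⟩ := exists_roots_of_discr_nonneg hp'
    obtain ⟨z, w, rfl, rfl⟩ := exists_roots_of_discr_nonneg hr'
    have := nonneg_of_real_roots (a := a) (b := b) (c := c) (x := x) (y := y) (z := z) (w := w)
      (by linarith) (by linarith) (by linarith) (by linarith) h1 h2 t
    linarith

theorem normalized_quartic_nonneg_iff (a b c : ℝ) :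
    (∀ t : ℝ, 0 ≤ t ^ 4 + 4 * a * t ^ 3 + 6 * c * t ^ 2 + 4 * b * t + 1) ↔
      0 ≤ (1 - 4 * a * b + 3 * c ^ 2) ^ 3 -
        27 * (c + 2 * a * c * b - c ^ 3 - b ^ 2 - a ^ 2) ^ 2 ∧
      |a - b| ≤ √(6 * c + 2) ∧
      ((-1 ≤ 3 * c ∧ c ≤ 1) ∨ (1 < c ∧ |a + b| ≤ √(6 * c - 2))) := by
  constructor
  · intro h
    have h1 := sub_sq_le_of_nonneg h
    refine ⟨discr_nonneg_of_nonneg h, Real.abs_le_sqrt h1, ?_⟩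
    rcases le_or_gt c 1 with hc | hc
    · exact Or.inl ⟨by nlinarith [sq_nonneg (a - b)], hc⟩
    · exact Or.inr ⟨hc, Real.abs_le_sqrt (add_sq_le_of_nonneg h hc)⟩
  · rintro ⟨hD, h1, h2⟩
    have hc : 0 ≤ 6 * c + 2 := by rcases h2 with h2 | h2 <;> linarith [h2.1]
    rw [Real.le_sqrt (abs_nonneg _) hc, sq_abs] at h1
    refine nonneg_of_discr_nonneg hD h1 ?_
    rcases h2 with h2 | ⟨hc1, h2⟩
    · exact Or.inl h2.2
    · rw [Real.le_sqrt (abs_nonneg _) (by linarith), sq_abs] at h2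
      exact Or.inr h2

theorem forall_binary_quartic_nonneg_iff (a b c : ℝ) {α β : ℝ} (hα : 0 < α) (hβ : 0 < β) :
    (∀ x1 x2 : ℝ,
        0 ≤ α ^ 4 * x1 ^ 4 + 4 * (a * α ^ 3 * β) * x1 ^ 3 * x2 +
          6 * (c * α ^ 2 * β ^ 2) * x1 ^ 2 * x2 ^ 2 + 4 * (b * α * β ^ 3) * x1 * x2 ^ 3 +
          β ^ 4 * x2 ^ 4) ↔
      ∀ t : ℝ, 0 ≤ t ^ 4 + 4 * a * t ^ 3 + 6 * c * t ^ 2 + 4 * b * t + 1 := by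
  constructor
  · intro h t
    convert h (t / α) (1 / β) using 1
    field_simp
  · intro h x1 x2
    rcases eq_or_ne x2 0 with rfl | hx
    · have : 0 ≤ α ^ 4 * x1 ^ 4 := by positivity
      linarith
    · have key := mul_nonneg (h (α * x1 / (β * x2))) (by positivity : 0 ≤ (β * x2) ^ 4)
      refine key.trans_eq ?_
      field_simp

theorem abs_mul_le_sqrt_iff {m u v : ℝ} (hm : 0 < m) : |m * u| ≤ √(m ^ 2 * v) ↔ |u| ≤ √v := by
  rw [abs_mul, abs_of_pos hm, Real.sqrt_mul (sq_nonneg m), Real.sqrt_sq hm.le,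
    mul_le_mul_iff_right₀ hm]

theorem tensor4dim2_psd_iff (v1111 v1112 v1122 v1222 v2222 : ℝ)
    (h1 : 0 < v1111) (h2 : 0 < v2222) :
    (∀ x1 x2 : ℝ,
        0 ≤ v1111 * x1 ^ 4 + 4 * v1112 * x1 ^ 3 * x2 + 6 * v1122 * x1 ^ 2 * x2 ^ 2 +
          4 * v1222 * x1 * x2 ^ 3 + v2222 * x2 ^ 4) ↔
      (0 ≤ (v1111 * v2222 - 4 * v1112 * v1222 + 3 * v1122 ^ 2) ^ 3 -
          27 * (v1111 * v1122 * v2222 + 2 * v1112 * v1122 * v1222 - v1122 ^ 3 -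
            v1111 * v1222 ^ 2 - v1112 ^ 2 * v2222) ^ 2 ∧
        |v1112 * Real.sqrt v2222 - v1222 * Real.sqrt v1111| ≤
          Real.sqrt (6 * v1111 * v1122 * v2222 +
            2 * Real.sqrt ((v1111 * v2222) ^ 3)) ∧
        ((-Real.sqrt (v1111 * v2222) ≤ 3 * v1122 ∧
            3 * v1122 ≤ 3 * Real.sqrt (v1111 * v2222)) ∨
          (Real.sqrt (v1111 * v2222) < v1122 ∧
            |v1112 * Real.sqrt v2222 + v1222 * Real.sqrt v1111| ≤
              Real.sqrt (6 * v1111 * v1122 * v2222 -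
                2 * Real.sqrt ((v1111 * v2222) ^ 3))))) := by
  obtain ⟨α, hα, rfl⟩ : ∃ α : ℝ, 0 < α ∧ α ^ 4 = v1111 :=
    ⟨√√v1111, by positivity, by
      rw [show (4 : ℕ) = 2 * 2 from rfl, pow_mul, Real.sq_sqrt (by positivity),
        Real.sq_sqrt h1.le]⟩
  obtain ⟨β, hβ, rfl⟩ : ∃ β : ℝ, 0 < β ∧ β ^ 4 = v2222 :=
    ⟨√√v2222, by positivity, by
      rw [show (4 : ℕ) = 2 * 2 from rfl, pow_mul, Real.sq_sqrt (by positivity),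
        Real.sq_sqrt h2.le]⟩
  obtain ⟨a, rfl⟩ : ∃ a, v1112 = a * α ^ 3 * β := ⟨v1112 / (α ^ 3 * β), by field_simp⟩
  obtain ⟨c, rfl⟩ : ∃ c, v1122 = c * α ^ 2 * β ^ 2 := ⟨v1122 / (α ^ 2 * β ^ 2), by field_simp⟩
  obtain ⟨b, rfl⟩ : ∃ b, v1222 = b * α * β ^ 3 := ⟨v1222 / (α * β ^ 3), by field_simp⟩
  rw [forall_binary_quartic_nonneg_iff a b c hα hβ, normalized_quartic_nonneg_iff]
  have hm : 0 < α ^ 2 * β ^ 2 := by positivity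
  have hn : 0 < α ^ 3 * β ^ 3 := by positivity
  have sα : √(α ^ 4) = α ^ 2 := by
    rw [show α ^ 4 = (α ^ 2) ^ 2 by ring, Real.sqrt_sq (by positivity)]
  have sβ : √(β ^ 4) = β ^ 2 := by
    rw [show β ^ 4 = (β ^ 2) ^ 2 by ring, Real.sqrt_sq (by positivity)]
  have sm : √(α ^ 4 * β ^ 4) = α ^ 2 * β ^ 2 := by
    rw [show α ^ 4 * β ^ 4 = (α ^ 2 * β ^ 2) ^ 2 by ring, Real.sqrt_sq hm.le]
  have sn : √((α ^ 4 * β ^ 4) ^ 3) = (α ^ 3 * β ^ 3) ^ 2 := by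
    rw [show (α ^ 4 * β ^ 4) ^ 3 = ((α ^ 3 * β ^ 3) ^ 2) ^ 2 by ring, Real.sqrt_sq (by positivity)]
  rw [sα, sβ, sm, sn]
  refine and_congr ?_ (and_congr ?_ (or_congr (and_congr ?_ ?_) (and_congr ?_ ?_)))
  · rw [← mul_nonneg_iff_of_pos_left (pow_pos hm 6)]
    ring_nf
  · rw [← abs_mul_le_sqrt_iff hn]
    ring_nf
  · rw [← mul_le_mul_iff_right₀ hm]
    ring_nf
  · rw [← mul_le_mul_iff_right₀ (mul_pos three_pos hm)]
    ring_nf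
  · rw [← mul_lt_mul_iff_right₀ hm]
    ring_nf
  · rw [← abs_mul_le_sqrt_iff hn]
    ring_nf
end
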